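/- Let γ > 1 and let α₀,…,α₈ be real Leslie coefficients with γ₁ := α₃ − α₂ and γ₂ := α₆ − α₅ satisfying the Parodi relation γ₂ = α₂ + α₃ and the empirical inequalities α₄ > 0; 2α₁ + 3α₄ + 2α₅ + 2α₆ > 0; γ₁ > 0; 2α₄ + α₅ + α₆ > 0; 4γ₁(2α₄ + α₅ + α₆) > (α₂ + α₃ + γ₂)²; α₄ + α₇ > α₁ + γ₂²/γ₁ ≥ 0; 2α₄ + α₅ + α₆ − γ₂²/γ₁ > α₀ + α₁ + α₅ + α₆ + α₈ ≥ 0. Then there exists a function C : [0,∞) × (0,∞) → [0,∞) (depending only on γ and the coefficients) such that for every T > 0 and every smooth solution (ρ, u, v, n) of the one-dimensional compressible Ericksen–Leslie system on [0,1] × [0,T] with ρ > 0 and boundary conditions u(0,t)=u(1,t)=v(0,t)=v(1,t)=0, n_x(0,t)=n_x(1,t)=0, one has ∫₀ᵀ∫₀¹ n_{xx}² dx dt + ∫₀ᵀ∫₀¹ n_t² dx dt ≤ C(E(0), T), where E(0) is the initial energy. -/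

import Mathlib

open Set intervalIntegral Real

noncomputable section

/-- Spatial partial derivative of a function of `(x, t)`. -/
def pdx (f : ℝ → ℝ → ℝ) (x t : ℝ) : ℝ := deriv (fun y => f y t) x

/-- Time partial derivative of a function of `(x, t)`. -/
def pdt (f : ℝ → ℝ → ℝ) (x t : ℝ) : ℝ := deriv (fun s => f x s) t

/-- The material derivative `ṅ = n_t + u n_x`. -/
def mdot (u n : ℝ → ℝ → ℝ) (x t : ℝ) : ℝ := pdt n x t + u x t * pdx n x t

/-- The second-order forcing term `J¹` in the `u`-equation of the one-dimensional
compressible Ericksen–Leslie system. -/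
def J1 (a0 a1 a2 a3 a4 a5 a6 a7 a8 : ℝ) (u v n : ℝ → ℝ → ℝ) (x t : ℝ) : ℝ :=
  (a0 + a5 + a6 + a8) * pdx (fun y s => pdx u y s * cos (n y s) ^ 2) x t
  + a1 * pdx (fun y s => pdx u y s * cos (n y s) ^ 4) x t
  - (a2 + a3) * pdx (fun y s => mdot u n y s * cos (n y s) * sin (n y s)) x t
  + (a4 + a7) * pdx (pdx u) x t
  + a0 * pdx (fun y s => pdx v y s * cos (n y s) * sin (n y s)) x t
  + a1 * pdx (fun y s => pdx v y s * cos (n y s) ^ 3 * sin (n y s)) x t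
  + (1 / 2) * (a2 + a3 + a5 + a6) * pdx (fun y s => pdx v y s * cos (n y s) * sin (n y s)) x t

/-- The second-order forcing term `J²` in the `v`-equation of the one-dimensional
compressible Ericksen–Leslie system. -/
def J2 (a1 a2 a3 a4 a5 a6 a8 : ℝ) (u v n : ℝ → ℝ → ℝ) (x t : ℝ) : ℝ :=
  a1 * pdx (fun y s => pdx u y s * cos (n y s) ^ 3 * sin (n y s)) x t
  + a2 * pdx (fun y s => mdot u n y s * cos (n y s) ^ 2) x t
  - a3 * pdx (fun y s => mdot u n y s * sin (n y s) ^ 2) x t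
  + (a6 + a8) * pdx (fun y s => pdx u y s * cos (n y s) * sin (n y s)) x t
  + a1 * pdx (fun y s => pdx v y s * cos (n y s) ^ 2 * sin (n y s) ^ 2) x t
  + (1 / 2) * (-a2 + a5) * pdx (fun y s => pdx v y s * cos (n y s) ^ 2) x t
  + (1 / 2) * (a3 + a6) * pdx (fun y s => pdx v y s * sin (n y s) ^ 2) x t
  + (1 / 2) * a4 * pdx (pdx v) x t

/-- `ELSystem γ a0 … a8 T ρ u v n` says that `(ρ, u, v, n)` is a smooth solution, with
positive density, of the one-dimensional compressible Ericksen–Leslie system on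
`[0,1] × [0,T]`, with the homogeneous boundary conditions
`u = v = 0`, `n_x = 0` at `x = 0, 1`. -/
def ELSystem (γ a0 a1 a2 a3 a4 a5 a6 a7 a8 T : ℝ) (ρ u v n : ℝ → ℝ → ℝ) : Prop :=
  ContDiff ℝ (⊤ : ℕ∞) (fun p : ℝ × ℝ => ρ p.1 p.2) ∧
  ContDiff ℝ (⊤ : ℕ∞) (fun p : ℝ × ℝ => u p.1 p.2) ∧
  ContDiff ℝ (⊤ : ℕ∞) (fun p : ℝ × ℝ => v p.1 p.2) ∧
  ContDiff ℝ (⊤ : ℕ∞) (fun p : ℝ × ℝ => n p.1 p.2) ∧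
  (∀ x ∈ Icc (0:ℝ) 1, ∀ t ∈ Icc (0:ℝ) T, 0 < ρ x t) ∧
  (∀ x ∈ Ioo (0:ℝ) 1, ∀ t ∈ Ioo (0:ℝ) T,
    pdt ρ x t + pdx (fun y s => ρ y s * u y s) x t = 0 ∧
    pdt (fun y s => ρ y s * u y s) x t + pdx (fun y s => ρ y s * u y s ^ 2) x t
        + pdx (fun y s => ρ y s ^ γ) x t
      = J1 a0 a1 a2 a3 a4 a5 a6 a7 a8 u v n x t - pdx (pdx n) x t * pdx n x t ∧
    pdt (fun y s => ρ y s * v y s) x t + pdx (fun y s => ρ y s * u y s * v y s) x t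
      = J2 a1 a2 a3 a4 a5 a6 a8 u v n x t ∧
    (a3 - a2) * (mdot u n x t - (1 / 2) * pdx v x t)
        - (a6 - a5) * (pdx u x t * cos (n x t) * sin (n x t)
            + (1 / 2) * pdx v x t * (1 - 2 * cos (n x t) ^ 2))
      = pdx (pdx n) x t) ∧
  (∀ t ∈ Icc (0:ℝ) T,
    u 0 t = 0 ∧ u 1 t = 0 ∧ v 0 t = 0 ∧ v 1 t = 0 ∧ pdx n 0 t = 0 ∧ pdx n 1 t = 0)

/-- The total energy `E(t)` of the one-dimensional compressible Ericksen–Leslie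
system. -/
def energy (γ : ℝ) (ρ u v n : ℝ → ℝ → ℝ) (t : ℝ) : ℝ :=
  (1 / 2) * (∫ x in (0:ℝ)..1, ρ x t * ((u x t) ^ 2 + (v x t) ^ 2))
  + (1 / (γ - 1)) * (∫ x in (0:ℝ)..1, ρ x t ^ γ)
  + (1 / 2) * (∫ x in (0:ℝ)..1, (pdx n x t) ^ 2)

abbrev Sm (f : ℝ → ℝ → ℝ) : Prop := ContDiff ℝ (⊤ : ℕ∞) (fun p : ℝ × ℝ => f p.1 p.2)

abbrev C1 (f : ℝ → ℝ → ℝ) : Prop := ContDiff ℝ 1 (fun p : ℝ × ℝ => f p.1 p.2)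

lemma Sm.c1 {f : ℝ → ℝ → ℝ} (h : Sm f) : C1 f := h.of_le (by exact_mod_cast le_top)

lemma C1.hx {f : ℝ → ℝ → ℝ} (h : C1 f) (x t : ℝ) :
    HasDerivAt (fun y => f y t) (fderiv ℝ (fun p : ℝ × ℝ => f p.1 p.2) (x, t) (1, 0)) x := by
  have h1 := (h.differentiable one_ne_zero (x, t)).hasFDerivAt
  have h2 : HasDerivAt (fun y : ℝ => (y, t)) ((1 : ℝ), (0 : ℝ)) x :=
    (hasDerivAt_id x).prodMk (hasDerivAt_const x t)
  exact HasFDerivAt.comp_hasDerivAt (f := fun y : ℝ => (y, t)) x h1 h2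

lemma C1.ht {f : ℝ → ℝ → ℝ} (h : C1 f) (x t : ℝ) :
    HasDerivAt (fun s => f x s) (fderiv ℝ (fun p : ℝ × ℝ => f p.1 p.2) (x, t) (0, 1)) t := by
  have h1 := (h.differentiable one_ne_zero (x, t)).hasFDerivAt
  have h2 : HasDerivAt (fun s : ℝ => (x, s)) ((0 : ℝ), (1 : ℝ)) t :=
    (hasDerivAt_const t x).prodMk (hasDerivAt_id t)
  exact HasFDerivAt.comp_hasDerivAt (f := fun s : ℝ => (x, s)) t h1 h2

lemma C1.pdx_eq {f : ℝ → ℝ → ℝ} (h : C1 f) (x t : ℝ) :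
    pdx f x t = fderiv ℝ (fun p : ℝ × ℝ => f p.1 p.2) (x, t) (1, 0) := (h.hx x t).deriv

lemma C1.pdt_eq {f : ℝ → ℝ → ℝ} (h : C1 f) (x t : ℝ) :
    pdt f x t = fderiv ℝ (fun p : ℝ × ℝ => f p.1 p.2) (x, t) (0, 1) := (h.ht x t).deriv

lemma C1.dx {f : ℝ → ℝ → ℝ} (h : C1 f) (x t : ℝ) :
    HasDerivAt (fun y => f y t) (pdx f x t) x := by
  rw [h.pdx_eq]; exact h.hx x t

lemma C1.dt {f : ℝ → ℝ → ℝ} (h : C1 f) (x t : ℝ) :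
    HasDerivAt (fun s => f x s) (pdt f x t) t := by
  rw [h.pdt_eq]; exact h.ht x t

lemma C1.cpdx {f : ℝ → ℝ → ℝ} (h : C1 f) : Continuous (fun p : ℝ × ℝ => pdx f p.1 p.2) := by
  have : (fun p : ℝ × ℝ => pdx f p.1 p.2)
      = fun p => fderiv ℝ (fun p : ℝ × ℝ => f p.1 p.2) p (1, 0) := by
    funext p; exact h.pdx_eq p.1 p.2
  rw [this]
  exact (h.continuous_fderiv one_ne_zero).clm_apply continuous_const

lemma C1.cpdt {f : ℝ → ℝ → ℝ} (h : C1 f) : Continuous (fun p : ℝ × ℝ => pdt f p.1 p.2) := by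
  have : (fun p : ℝ × ℝ => pdt f p.1 p.2)
      = fun p => fderiv ℝ (fun p : ℝ × ℝ => f p.1 p.2) p (0, 1) := by
    funext p; exact h.pdt_eq p.1 p.2
  rw [this]
  exact (h.continuous_fderiv one_ne_zero).clm_apply continuous_const

lemma Sm.fd {f : ℝ → ℝ → ℝ} (h : Sm f) :
    ContDiff ℝ (⊤ : ℕ∞) (fderiv ℝ (fun p : ℝ × ℝ => f p.1 p.2)) :=
  ContDiff.fderiv_right (m := ((⊤ : ℕ∞) : WithTop ℕ∞)) h (by exact_mod_cast le_top)

lemma Sm.pdx {f : ℝ → ℝ → ℝ} (h : Sm f) : Sm (pdx f) := by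
  have : (fun p : ℝ × ℝ => _root_.pdx f p.1 p.2)
      = fun p => fderiv ℝ (fun p : ℝ × ℝ => f p.1 p.2) p (1, 0) := by
    funext p; exact h.c1.pdx_eq p.1 p.2
  unfold Sm; rw [this]
  exact h.fd.clm_apply contDiff_const

lemma Sm.pdt {f : ℝ → ℝ → ℝ} (h : Sm f) : Sm (pdt f) := by
  have : (fun p : ℝ × ℝ => _root_.pdt f p.1 p.2)
      = fun p => fderiv ℝ (fun p : ℝ × ℝ => f p.1 p.2) p (0, 1) := by
    funext p; exact h.c1.pdt_eq p.1 p.2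
  unfold Sm; rw [this]
  exact h.fd.clm_apply contDiff_const

lemma Sm.symm {f : ℝ → ℝ → ℝ} (h : Sm f) (x t : ℝ) :
    _root_.pdt (_root_.pdx f) x t = _root_.pdx (_root_.pdt f) x t := by
  have e1 : (fun p : ℝ × ℝ => _root_.pdx f p.1 p.2)
      = fun p => fderiv ℝ (fun p : ℝ × ℝ => f p.1 p.2) p (1, 0) := by
    funext p; exact h.c1.pdx_eq p.1 p.2
  have e2 : (fun p : ℝ × ℝ => _root_.pdt f p.1 p.2)
      = fun p => fderiv ℝ (fun p : ℝ × ℝ => f p.1 p.2) p (0, 1) := by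
    funext p; exact h.c1.pdt_eq p.1 p.2
  rw [h.pdx.c1.pdt_eq, h.pdt.c1.pdx_eq, e1, e2]
  have hd : DifferentiableAt ℝ (fderiv ℝ (fun p : ℝ × ℝ => f p.1 p.2)) (x, t) :=
    h.fd.differentiable (by simp) (x, t)
  rw [fderiv_clm_apply hd (by fun_prop), fderiv_clm_apply hd (by fun_prop)]
  have hs : IsSymmSndFDerivAt ℝ (fun p : ℝ × ℝ => f p.1 p.2) (x, t) :=
    (ContDiff.contDiffAt h).isSymmSndFDerivAt (by
      rw [minSmoothness_of_isRCLikeNormedField]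
      exact WithTop.coe_le_coe.2 (le_top : (2 : ℕ∞) ≤ ⊤))
  have := hs.eq (0, 1) (1, 0)
  simpa using this

lemma green {e F : ℝ → ℝ → ℝ} (he : C1 e) (hF : C1 F) (τ : ℝ) :
    ∫ t in (0:ℝ)..τ, ∫ x in (0:ℝ)..1, (pdt e x t + pdx F x t)
      = (∫ x in (0:ℝ)..1, e x τ) - (∫ x in (0:ℝ)..1, e x 0)
        + ∫ t in (0:ℝ)..τ, (F 1 t - F 0 t) := by
  have ct := he.cpdt
  have cx := hF.cpdx
  have ce := he.continuous
  have c1 : Continuous (fun t => ∫ x in (0:ℝ)..1, pdt e x t) := by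
    apply intervalIntegral.continuous_parametric_intervalIntegral_of_continuous'
    exact ct.comp continuous_swap
  have c2 : Continuous (fun t => ∫ x in (0:ℝ)..1, pdx F x t) := by
    apply intervalIntegral.continuous_parametric_intervalIntegral_of_continuous'
    exact cx.comp continuous_swap
  have ctx : ∀ t, Continuous fun x => pdt e x t := fun t => ct.comp (Continuous.prodMk_left t)
  have ctt : ∀ x, Continuous fun t => pdt e x t := fun x => ct.comp (Continuous.prodMk_right x)
  have cxx : ∀ t, Continuous fun x => pdx F x t := fun t => cx.comp (Continuous.prodMk_left t)
  have s1 : ∀ t, ∫ x in (0:ℝ)..1, (pdt e x t + pdx F x t)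
      = (∫ x in (0:ℝ)..1, pdt e x t) + ∫ x in (0:ℝ)..1, pdx F x t := fun t =>
    intervalIntegral.integral_add ((ctx t).intervalIntegrable _ _) ((cxx t).intervalIntegrable _ _)
  simp_rw [s1]
  rw [intervalIntegral.integral_add (c1.intervalIntegrable _ _) (c2.intervalIntegrable _ _)]
  congr 1
  · have hint : MeasureTheory.IntegrableOn (Function.uncurry fun t x => pdt e x t)
        (Set.uIoc 0 τ ×ˢ Set.uIoc (0:ℝ) 1) := by
      have hc : Continuous (Function.uncurry fun t x => pdt e x t) := ct.comp continuous_swap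
      have := hc.continuousOn.integrableOn_compact (μ := MeasureTheory.volume)
        ((isCompact_uIcc (a := (0:ℝ)) (b := τ)).prod (isCompact_uIcc (a := (0:ℝ)) (b := 1)))
      exact this.mono_set (Set.prod_mono Set.uIoc_subset_uIcc Set.uIoc_subset_uIcc)
    rw [MeasureTheory.intervalIntegral_intervalIntegral_swap hint]
    rw [← intervalIntegral.integral_sub]
    · congr 1; funext x
      exact intervalIntegral.integral_eq_sub_of_hasDerivAt (fun t _ => he.dt x t)
        ((ctt x).intervalIntegrable _ _)
    · exact (ce.comp (Continuous.prodMk_left τ)).intervalIntegrable _ _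
    · exact (ce.comp (Continuous.prodMk_left 0)).intervalIntegrable _ _
  · congr 1; funext t
    exact intervalIntegral.integral_eq_sub_of_hasDerivAt (fun x _ => hF.dx x t)
        ((cxx t).intervalIntegrable _ _)

lemma poinc {w : ℝ → ℝ → ℝ} (h : C1 w) (t : ℝ) (h0 : w 0 t = 0) (x : ℝ) (hx : x ∈ Icc (0:ℝ) 1) :
    w x t ^ 2 ≤ ∫ y in (0:ℝ)..1, pdx w y t ^ 2 := by
  have cx : Continuous fun y => pdx w y t := h.cpdx.comp (Continuous.prodMk_left t)
  have c2 : Continuous fun y => pdx w y t ^ 2 := cx.pow 2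
  have f1 : ∫ y in (0:ℝ)..x, pdx w y t = w x t := by
    rw [intervalIntegral.integral_eq_sub_of_hasDerivAt (fun y _ => h.dx y t)
        (cx.intervalIntegrable _ _), h0, sub_zero]
  have f2 : 0 ≤ ∫ y in (0:ℝ)..x, (pdx w y t - w x t) ^ 2 :=
    intervalIntegral.integral_nonneg hx.1 fun y _ => sq_nonneg _
  have f3 : ∫ y in (0:ℝ)..x, (pdx w y t - w x t) ^ 2
      = (∫ y in (0:ℝ)..x, pdx w y t ^ 2) - 2 * w x t * (∫ y in (0:ℝ)..x, pdx w y t)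
        + x * w x t ^ 2 := by
    have : ∀ y, (pdx w y t - w x t) ^ 2
      = (pdx w y t ^ 2 - 2 * w x t * pdx w y t) + w x t ^ 2 := fun y => by ring
    simp_rw [this]
    rw [intervalIntegral.integral_add, intervalIntegral.integral_sub,
      intervalIntegral.integral_const_mul, intervalIntegral.integral_const]
    · simp
    all_goals apply Continuous.intervalIntegrable; fun_prop
  have f4 : (∫ y in (0:ℝ)..1, pdx w y t ^ 2)
      = (∫ y in (0:ℝ)..x, pdx w y t ^ 2) + ∫ y in x..1, pdx w y t ^ 2 :=
    (intervalIntegral.integral_add_adjacent_intervals (c2.intervalIntegrable _ _)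
      (c2.intervalIntegrable _ _)).symm
  have f5 : 0 ≤ ∫ y in x..1, pdx w y t ^ 2 :=
    intervalIntegral.integral_nonneg hx.2 fun y _ => sq_nonneg _
  rw [f3, f1] at f2
  nlinarith [sq_nonneg (w x t), hx.2]

/-- first stress -/
def S1 (a0 a1 a2 a3 a4 a5 a6 a7 a8 : ℝ) (u v n : ℝ → ℝ → ℝ) (y s : ℝ) : ℝ :=
  (a0 + a5 + a6 + a8) * (pdx u y s * cos (n y s) ^ 2)
  + a1 * (pdx u y s * cos (n y s) ^ 4)
  - (a2 + a3) * (mdot u n y s * cos (n y s) * sin (n y s))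
  + (a4 + a7) * (pdx u y s)
  + a0 * (pdx v y s * cos (n y s) * sin (n y s))
  + a1 * (pdx v y s * cos (n y s) ^ 3 * sin (n y s))
  + (1 / 2) * (a2 + a3 + a5 + a6) * (pdx v y s * cos (n y s) * sin (n y s))

/-- second stress -/
def S2 (a1 a2 a3 a4 a5 a6 a8 : ℝ) (u v n : ℝ → ℝ → ℝ) (y s : ℝ) : ℝ :=
  a1 * (pdx u y s * cos (n y s) ^ 3 * sin (n y s))
  + a2 * (mdot u n y s * cos (n y s) ^ 2)
  - a3 * (mdot u n y s * sin (n y s) ^ 2)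
  + (a6 + a8) * (pdx u y s * cos (n y s) * sin (n y s))
  + a1 * (pdx v y s * cos (n y s) ^ 2 * sin (n y s) ^ 2)
  + (1 / 2) * (-a2 + a5) * (pdx v y s * cos (n y s) ^ 2)
  + (1 / 2) * (a3 + a6) * (pdx v y s * sin (n y s) ^ 2)
  + (1 / 2) * a4 * (pdx v y s)

lemma Sm.mdot {u n : ℝ → ℝ → ℝ} (hu : Sm u) (hn : Sm n) : Sm (mdot u n) :=
  ContDiff.add hn.pdt (ContDiff.mul hu hn.pdx)

lemma S1_c1 (a0 a1 a2 a3 a4 a5 a6 a7 a8 : ℝ) {u v n : ℝ → ℝ → ℝ} (hu : Sm u) (hv : Sm v)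
    (hn : Sm n) : C1 (S1 a0 a1 a2 a3 a4 a5 a6 a7 a8 u v n) := by
  have h1 := hu.pdx.c1
  have h2 := hv.pdx.c1
  have h3 := (Sm.mdot hu hn).c1
  have h4 := hn.c1
  unfold C1 S1 at *
  fun_prop

lemma S2_c1 (a1 a2 a3 a4 a5 a6 a8 : ℝ) {u v n : ℝ → ℝ → ℝ} (hu : Sm u) (hv : Sm v)
    (hn : Sm n) : C1 (S2 a1 a2 a3 a4 a5 a6 a8 u v n) := by
  have h1 := hu.pdx.c1
  have h2 := hv.pdx.c1
  have h3 := (Sm.mdot hu hn).c1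
  have h4 := hn.c1
  unfold C1 S2 at *
  fun_prop

lemma S1_dx (a0 a1 a2 a3 a4 a5 a6 a7 a8 : ℝ) {u v n : ℝ → ℝ → ℝ} (hu : Sm u) (hv : Sm v)
    (hn : Sm n) (x t : ℝ) : HasDerivAt (fun y => S1 a0 a1 a2 a3 a4 a5 a6 a7 a8 u v n y t)
      (J1 a0 a1 a2 a3 a4 a5 a6 a7 a8 u v n x t) x := by
  have h1 := hu.pdx.c1
  have h2 := hv.pdx.c1
  have h3 := (Sm.mdot hu hn).c1
  have h4 := hn.c1
  have g1 : C1 (fun y s => pdx u y s * cos (n y s) ^ 2) := by unfold C1 at *; fun_prop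
  have g2 : C1 (fun y s => pdx u y s * cos (n y s) ^ 4) := by unfold C1 at *; fun_prop
  have g3 : C1 (fun y s => mdot u n y s * cos (n y s) * sin (n y s)) := by
    unfold C1 at *; fun_prop
  have g4 : C1 (fun y s => pdx v y s * cos (n y s) * sin (n y s)) := by unfold C1 at *; fun_prop
  have g5 : C1 (fun y s => pdx v y s * cos (n y s) ^ 3 * sin (n y s)) := by
    unfold C1 at *; fun_prop
  exact (((((((g1.dx x t).const_mul _).add ((g2.dx x t).const_mul _)).sub
    ((g3.dx x t).const_mul _)).add ((h1.dx x t).const_mul _)).add ((g4.dx x t).const_mul _)).add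
    ((g5.dx x t).const_mul _)).add ((g4.dx x t).const_mul _)

lemma S2_dx (a1 a2 a3 a4 a5 a6 a8 : ℝ) {u v n : ℝ → ℝ → ℝ} (hu : Sm u) (hv : Sm v)
    (hn : Sm n) (x t : ℝ) : HasDerivAt (fun y => S2 a1 a2 a3 a4 a5 a6 a8 u v n y t)
      (J2 a1 a2 a3 a4 a5 a6 a8 u v n x t) x := by
  have h1 := hu.pdx.c1
  have h2 := hv.pdx.c1
  have h3 := (Sm.mdot hu hn).c1
  have h4 := hn.c1
  have g1 : C1 (fun y s => pdx u y s * cos (n y s) ^ 3 * sin (n y s)) := by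
    unfold C1 at *; fun_prop
  have g2 : C1 (fun y s => mdot u n y s * cos (n y s) ^ 2) := by unfold C1 at *; fun_prop
  have g3 : C1 (fun y s => mdot u n y s * sin (n y s) ^ 2) := by unfold C1 at *; fun_prop
  have g4 : C1 (fun y s => pdx u y s * cos (n y s) * sin (n y s)) := by unfold C1 at *; fun_prop
  have g5 : C1 (fun y s => pdx v y s * cos (n y s) ^ 2 * sin (n y s) ^ 2) := by
    unfold C1 at *; fun_prop
  have g6 : C1 (fun y s => pdx v y s * cos (n y s) ^ 2) := by unfold C1 at *; fun_prop
  have g7 : C1 (fun y s => pdx v y s * sin (n y s) ^ 2) := by unfold C1 at *; fun_prop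
  exact ((((((((g1.dx x t).const_mul _).add ((g2.dx x t).const_mul _)).sub
    ((g3.dx x t).const_mul _)).add ((g4.dx x t).const_mul _)).add ((g5.dx x t).const_mul _)).add
    ((g6.dx x t).const_mul _)).add ((g7.dx x t).const_mul _)).add ((h2.dx x t).const_mul _)

/-- energy density -/
def eden (γ : ℝ) (ρ u v n : ℝ → ℝ → ℝ) (x t : ℝ) : ℝ :=
  (1 / 2) * (ρ x t * ((u x t) ^ 2 + (v x t) ^ 2)) + (1 / (γ - 1)) * (ρ x t ^ γ)
    + (1 / 2) * (pdx n x t) ^ 2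

/-- energy flux -/
def eflux (γ a0 a1 a2 a3 a4 a5 a6 a7 a8 : ℝ) (ρ u v n : ℝ → ℝ → ℝ) (x t : ℝ) : ℝ :=
  (1 / 2) * (ρ x t * u x t * ((u x t) ^ 2 + (v x t) ^ 2))
    + (γ / (γ - 1)) * (ρ x t ^ γ * u x t)
    - u x t * S1 a0 a1 a2 a3 a4 a5 a6 a7 a8 u v n x t
    - v x t * S2 a1 a2 a3 a4 a5 a6 a8 u v n x t
    - pdx n x t * pdt n x t

lemma rpow_c1 {γ : ℝ} (hγ : 1 < γ) {ρ : ℝ → ℝ → ℝ} (h : C1 ρ) : C1 (fun x t => ρ x t ^ γ) := by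
  have := Real.contDiff_rpow_const_of_le (p := γ) (n := 1) (by simpa using hγ.le)
  have h2 := this.comp h
  exact_mod_cast h2

lemma eden_c1 {γ : ℝ} (hγ : 1 < γ) {ρ u v n : ℝ → ℝ → ℝ} (hρ : Sm ρ) (hu : Sm u) (hv : Sm v)
    (hn : Sm n) : C1 (eden γ ρ u v n) := by
  have h1 := hρ.c1
  have h2 := hu.c1
  have h3 := hv.c1
  have h4 := hn.pdx.c1
  have h5 := rpow_c1 hγ h1
  unfold C1 eden at *
  fun_prop

lemma eflux_c1 {γ : ℝ} (hγ : 1 < γ) (a0 a1 a2 a3 a4 a5 a6 a7 a8 : ℝ) {ρ u v n : ℝ → ℝ → ℝ}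
    (hρ : Sm ρ) (hu : Sm u) (hv : Sm v)
    (hn : Sm n) : C1 (eflux γ a0 a1 a2 a3 a4 a5 a6 a7 a8 ρ u v n) := by
  have h1 := hρ.c1
  have h2 := hu.c1
  have h3 := hv.c1
  have h4 := hn.pdx.c1
  have h5 := rpow_c1 hγ h1
  have h6 := hn.pdt.c1
  have h7 := S1_c1 a0 a1 a2 a3 a4 a5 a6 a7 a8 hu hv hn
  have h8 := S2_c1 a1 a2 a3 a4 a5 a6 a8 hu hv hn
  unfold C1 eflux at *
  fun_prop

lemma energy_identity {γ a0 a1 a2 a3 a4 a5 a6 a7 a8 T : ℝ} {ρ u v n : ℝ → ℝ → ℝ} (hγ : 1 < γ)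
    (H : ELSystem γ a0 a1 a2 a3 a4 a5 a6 a7 a8 T ρ u v n) {x t : ℝ} (hx : x ∈ Ioo (0:ℝ) 1)
    (ht : t ∈ Ioo (0:ℝ) T) :
    pdt (eden γ ρ u v n) x t + pdx (eflux γ a0 a1 a2 a3 a4 a5 a6 a7 a8 ρ u v n) x t
      = -(mdot u n x t * pdx (pdx n) x t
          + pdx u x t * S1 a0 a1 a2 a3 a4 a5 a6 a7 a8 u v n x t
          + pdx v x t * S2 a1 a2 a3 a4 a5 a6 a8 u v n x t) := by
  obtain ⟨hρ, hu, hv, hn, hpos, hpde, -⟩ := H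
  obtain ⟨p1, p2, p3, -⟩ := hpde x hx t ht
  have hp := hpos x (Ioo_subset_Icc_self hx) t (Ioo_subset_Icc_self ht)
  have rx := Sm.c1 hρ |>.dx x t
  have rt := Sm.c1 hρ |>.dt x t
  have ux := Sm.c1 hu |>.dx x t
  have ut := Sm.c1 hu |>.dt x t
  have vx := Sm.c1 hv |>.dx x t
  have vt := Sm.c1 hv |>.dt x t
  have nxx := (Sm.pdx hn).c1.dx x t
  have nxt := (Sm.pdx hn).c1.dt x t
  have ntx := (Sm.pdt hn).c1.dx x t
  have sym := Sm.symm hn x t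
  have s1 := S1_dx a0 a1 a2 a3 a4 a5 a6 a7 a8 hu hv hn x t
  have s2 := S2_dx a1 a2 a3 a4 a5 a6 a8 hu hv hn x t
  have rgx := rx.rpow_const (p := γ) (Or.inl hp.ne')
  have rgt := rt.rpow_const (p := γ) (Or.inl hp.ne')
  have q1 : pdx (fun y s => ρ y s * u y s) x t = _ := (rx.mul ux).deriv
  have q2 : pdt (fun y s => ρ y s * u y s) x t = _ := (rt.mul ut).deriv
  have q3 : pdx (fun y s => ρ y s * u y s ^ 2) x t = _ := (rx.mul (ux.pow 2)).deriv
  have q4 : pdx (fun y s => ρ y s ^ γ) x t = _ := rgx.deriv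
  have q5 : pdt (fun y s => ρ y s * v y s) x t = _ := (rt.mul vt).deriv
  have q6 : pdx (fun y s => ρ y s * u y s * v y s) x t = _ := ((rx.mul ux).mul vx).deriv
  have q7 : pdt (eden γ ρ u v n) x t = _ :=
    ((((rt.mul ((ut.pow 2).add (vt.pow 2))).const_mul (1/2)).add (rgt.const_mul (1/(γ-1)))).add
      ((nxt.pow 2).const_mul (1/2))).deriv
  have q8 : pdx (eflux γ a0 a1 a2 a3 a4 a5 a6 a7 a8 ρ u v n) x t = _ :=
    ((((((((rx.mul ux).mul ((ux.pow 2).add (vx.pow 2))).const_mul (1/2)).add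
      ((rgx.mul ux).const_mul (γ/(γ-1)))).sub (ux.mul s1)).sub (vx.mul s2)).sub
      (nxx.mul ntx))).deriv
  rw [q1] at p1
  rw [q2, q3, q4] at p2
  rw [q5, q6] at p3
  rw [q7, q8, sym]
  have hr : ρ x t ^ γ = ρ x t * ρ x t ^ (γ - 1) := by
    rw [Real.rpow_sub_one hp.ne']; field_simp
  simp only [Pi.mul_apply, Pi.add_apply, Pi.pow_apply] at *
  rw [hr]
  generalize ρ x t ^ (γ - 1) = R at *
  have hg : γ - 1 ≠ 0 := by linarith
  generalize S1 a0 a1 a2 a3 a4 a5 a6 a7 a8 u v n x t = s1 at *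
  generalize S2 a1 a2 a3 a4 a5 a6 a8 u v n x t = s2 at *
  generalize J1 a0 a1 a2 a3 a4 a5 a6 a7 a8 u v n x t = j1 at *
  generalize J2 a1 a2 a3 a4 a5 a6 a8 u v n x t = j2 at *
  unfold mdot
  norm_num at p1 p2 p3 ⊢
  clear q1 q2 q3 q4 q5 q6 q7 q8 rgx rgt
  obtain ⟨g, hgg⟩ : ∃ g, g = (γ - 1)⁻¹ := ⟨_, rfl⟩
  have hg1 : g * (γ - 1) = 1 := by rw [hgg]; exact inv_mul_cancel₀ hg
  simp only [div_eq_mul_inv, ← hgg]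
  have hq : γ * g = 1 + g := by linarith
  linear_combination (γ * g * R - (1/2) * (u x t ^ 2 + v x t ^ 2)) * p1 + u x t * p2
    + v x t * p3 + (pdx ρ x t * u x t * R * γ + 0) * hg1

lemma quad_alg {A M P L U V c s : ℝ} (hA : 0 ≤ A) (hM : 0 ≤ M) (hcs : s ^ 2 = 1 - c ^ 2) :
    (P - M) * U ^ 2 + (L - A) / 4 * V ^ 2 ≤
      U ^ 2 * (A * c ^ 2 + P - M * (c ^ 2 * s ^ 2)) + U * V * (c * s) * (A + M * (2 * c ^ 2 - 1))
        + V ^ 2 * (M * (c ^ 2 * s ^ 2) + L / 4) := by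
  have e1 : 0 ≤ A * (c * U + s * V / 2) ^ 2 := mul_nonneg hA (sq_nonneg _)
  have e2 : 0 ≤ A * (c * V / 2) ^ 2 := mul_nonneg hA (sq_nonneg _)
  have e3 : 0 ≤ M * ((c * s * V + (2 * c ^ 2 - 1) / 2 * U) ^ 2 + 3 / 4 * U ^ 2) := by positivity
  have e : U ^ 2 * (A * c ^ 2 + P - M * (c ^ 2 * s ^ 2))
        + U * V * (c * s) * (A + M * (2 * c ^ 2 - 1))
        + V ^ 2 * (M * (c ^ 2 * s ^ 2) + L / 4) - ((P - M) * U ^ 2 + (L - A) / 4 * V ^ 2)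
      = A * (c * U + s * V / 2) ^ 2 + A * (c * V / 2) ^ 2
        + M * ((c * s * V + (2 * c ^ 2 - 1) / 2 * U) ^ 2 + 3 / 4 * U ^ 2) := by
    linear_combination (- A * V ^ 2 / 4 - M * U ^ 2 * c ^ 2) * hcs
  linarith

lemma diss {a0 a1 a2 a3 a4 a5 a6 a7 a8 N Z U V c s : ℝ} (hParodi : a6 - a5 = a2 + a3)
    (h3 : 0 < a3 - a2)
    (h6' : 0 ≤ a1 + (a6 - a5) ^ 2 / (a3 - a2))
    (h7' : 0 ≤ a0 + a1 + a5 + a6 + a8)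
    (hcs : s ^ 2 = 1 - c ^ 2)
    (hZ : (a3 - a2) * (N - (1 / 2) * V) - (a6 - a5) * (U * c * s + (1 / 2) * V * (1 - 2 * c ^ 2))
      = Z) :
    1 / (a3 - a2) * Z ^ 2 + (a4 + a7 - (a1 + (a6 - a5) ^ 2 / (a3 - a2))) * U ^ 2
      + (2 * a4 + a5 + a6 - (a6 - a5) ^ 2 / (a3 - a2) - (a0 + a1 + a5 + a6 + a8)) / 4 * V ^ 2
    ≤ N * Z + U * ((a0 + a5 + a6 + a8) * (U * c ^ 2)
      + a1 * (U * c ^ 4)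
      - (a2 + a3) * (N * c * s)
      + (a4 + a7) * U
      + a0 * (V * c * s)
      + a1 * (V * c ^ 3 * s)
      + (1 / 2) * (a2 + a3 + a5 + a6) * (V * c * s))
     + V * (a1 * (U * c ^ 3 * s)
      + a2 * (N * c ^ 2)
      - a3 * (N * s ^ 2)
      + (a6 + a8) * (U * c * s)
      + a1 * (V * c ^ 2 * s ^ 2)
      + (1 / 2) * (-a2 + a5) * (V * c ^ 2)
      + (1 / 2) * (a3 + a6) * (V * s ^ 2)
      + (1 / 2) * a4 * V) := by
  have q := quad_alg (A := a0 + a1 + a5 + a6 + a8) (M := a1 + (a6 - a5) ^ 2 / (a3 - a2))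
    (P := a4 + a7) (L := 2 * a4 + a5 + a6 - (a6 - a5) ^ 2 / (a3 - a2)) (U := U) (V := V) (c := c)
    (s := s) h7' h6' hcs
  refine le_of_sub_nonneg ?_
  refine (sub_nonneg.2 q).trans (le_of_eq ?_)
  obtain ⟨g, hg⟩ : ∃ g, g = (a3 - a2)⁻¹ := ⟨_, rfl⟩
  have hg1 : g * (a3 - a2) = 1 := by rw [hg]; exact inv_mul_cancel₀ h3.ne'
  simp only [div_eq_mul_inv, ← hg]
  obtain ⟨y, hy⟩ : ∃ y, y = a3 - a2 := ⟨_, rfl⟩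
  obtain ⟨w, hw⟩ : ∃ w, w = a2 + a3 := ⟨_, rfl⟩
  obtain ⟨S, hS⟩ : ∃ S, S = a5 + a6 := ⟨_, rfl⟩
  obtain rfl : a2 = (w - y) / 2 := by linarith
  obtain rfl : a3 = (w + y) / 2 := by linarith
  obtain rfl : a5 = (S - w) / 2 := by linarith
  obtain rfl : a6 = (S + w) / 2 := by linarith
  have hy2 : (w + y) / 2 - (w - y) / 2 = y := by ring
  have hw2 : (S + w) / 2 - (S - w) / 2 = w := by ring
  rw [hy2] at hg1 hZ
  rw [hw2] at hZ
  clear hg hy hw hS q h3 h6' h7' hParodi hy2 hw2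
  subst hZ
  grind

/-- controlled quantity -/
def Wq (u v n : ℝ → ℝ → ℝ) (x t : ℝ) : ℝ :=
  pdx (pdx n) x t ^ 2 + pdx u x t ^ 2 + pdx v x t ^ 2

lemma cont_param {f : ℝ → ℝ → ℝ} (h : Continuous (fun p : ℝ × ℝ => f p.1 p.2)) :
    Continuous (fun t => ∫ x in (0:ℝ)..1, f x t) := by
  apply intervalIntegral.continuous_parametric_intervalIntegral_of_continuous'
  exact h.comp continuous_swap

lemma cont_x {f : ℝ → ℝ → ℝ} (h : Continuous (fun p : ℝ × ℝ => f p.1 p.2)) (t : ℝ) :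
    Continuous (fun x => f x t) := h.comp (Continuous.prodMk_left t)

lemma dbl_mono {f g : ℝ → ℝ → ℝ} (hf : Continuous (fun p : ℝ × ℝ => f p.1 p.2))
    (hg : Continuous (fun p : ℝ × ℝ => g p.1 p.2)) {τ : ℝ} (hτ : 0 ≤ τ)
    (h : ∀ x ∈ Ioo (0:ℝ) 1, ∀ t ∈ Ioo (0:ℝ) τ, f x t ≤ g x t) :
    ∫ t in (0:ℝ)..τ, ∫ x in (0:ℝ)..1, f x t ≤ ∫ t in (0:ℝ)..τ, ∫ x in (0:ℝ)..1, g x t := by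
  apply intervalIntegral.integral_mono_on_of_le_Ioo hτ ((cont_param hf).intervalIntegrable _ _)
    ((cont_param hg).intervalIntegrable _ _)
  intro t ht
  exact intervalIntegral.integral_mono_on_of_le_Ioo zero_le_one
    ((cont_x hf t).intervalIntegrable _ _) ((cont_x hg t).intervalIntegrable _ _)
    fun x hx => h x hx t ht

lemma Wq_cont {u v n : ℝ → ℝ → ℝ} (hu : Sm u) (hv : Sm v) (hn : Sm n) :
    Continuous (fun p : ℝ × ℝ => Wq u v n p.1 p.2) := by
  have h1 := hu.pdx.continuous
  have h2 := hv.pdx.continuous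
  have h3 := hn.pdx.pdx.continuous
  unfold Wq
  exact ((h3.pow 2).add (h1.pow 2)).add (h2.pow 2)

lemma energy_eq {γ : ℝ} (hγ : 1 < γ) {ρ u v n : ℝ → ℝ → ℝ} (hρ : Sm ρ) (hu : Sm u) (hv : Sm v)
    (hn : Sm n) (t : ℝ) : energy γ ρ u v n t = ∫ x in (0:ℝ)..1, eden γ ρ u v n x t := by
  have h1 := cont_x hρ.continuous t
  have h2 := cont_x hu.continuous t
  have h3 := cont_x hv.continuous t
  have h4 := cont_x hn.pdx.continuous t
  have h5 := cont_x (f := fun x t => ρ x t ^ γ) (rpow_c1 hγ hρ.c1).continuous t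
  unfold energy eden
  rw [intervalIntegral.integral_add, intervalIntegral.integral_add,
    intervalIntegral.integral_const_mul, intervalIntegral.integral_const_mul,
    intervalIntegral.integral_const_mul]
  all_goals apply Continuous.intervalIntegrable; fun_prop

lemma energy_ge {γ a0 a1 a2 a3 a4 a5 a6 a7 a8 T : ℝ} {ρ u v n : ℝ → ℝ → ℝ} (hγ : 1 < γ)
    (H : ELSystem γ a0 a1 a2 a3 a4 a5 a6 a7 a8 T ρ u v n) {t : ℝ} (ht : t ∈ Icc (0:ℝ) T) :
    (1 / 2) * (∫ x in (0:ℝ)..1, (pdx n x t) ^ 2) ≤ energy γ ρ u v n t := by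
  obtain ⟨-, -, -, -, hpos, -, -⟩ := H
  have g1 : 0 ≤ ∫ x in (0:ℝ)..1, ρ x t * ((u x t) ^ 2 + (v x t) ^ 2) :=
    intervalIntegral.integral_nonneg zero_le_one fun x hx =>
      mul_nonneg (hpos x hx t ht).le (by positivity)
  have g2 : 0 ≤ ∫ x in (0:ℝ)..1, ρ x t ^ γ :=
    intervalIntegral.integral_nonneg zero_le_one fun x hx =>
      Real.rpow_nonneg (hpos x hx t ht).le _
  have g3 : 0 ≤ 1 / (γ - 1) := one_div_nonneg.2 (by linarith)
  have := mul_nonneg g3 g2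
  unfold energy
  linarith

lemma energy_ineq {γ a0 a1 a2 a3 a4 a5 a6 a7 a8 T c0 : ℝ} {ρ u v n : ℝ → ℝ → ℝ} (hγ : 1 < γ)
    (hParodi : a6 - a5 = a2 + a3)
    (h3 : 0 < a3 - a2)
    (h6' : 0 ≤ a1 + (a6 - a5) ^ 2 / (a3 - a2))
    (h7' : 0 ≤ a0 + a1 + a5 + a6 + a8)
    (k1 : c0 ≤ 1 / (a3 - a2))
    (k2 : c0 ≤ a4 + a7 - (a1 + (a6 - a5) ^ 2 / (a3 - a2)))
    (k3 : c0 ≤ (2 * a4 + a5 + a6 - (a6 - a5) ^ 2 / (a3 - a2) - (a0 + a1 + a5 + a6 + a8)) / 4)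
    (H : ELSystem γ a0 a1 a2 a3 a4 a5 a6 a7 a8 T ρ u v n) {τ : ℝ} (hτ : τ ∈ Icc (0:ℝ) T) :
    energy γ ρ u v n τ + c0 * (∫ t in (0:ℝ)..τ, ∫ x in (0:ℝ)..1, Wq u v n x t)
      ≤ energy γ ρ u v n 0 := by
  have H' := H
  obtain ⟨hρ, hu, hv, hn, -, hpde, hbc⟩ := H'
  have ce := eden_c1 hγ hρ hu hv hn
  have cF := eflux_c1 hγ a0 a1 a2 a3 a4 a5 a6 a7 a8 hρ hu hv hn
  have G := green ce cF τ
  rw [← energy_eq hγ hρ hu hv hn, ← energy_eq hγ hρ hu hv hn] at G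
  have hz : ∫ t in (0:ℝ)..τ, (eflux γ a0 a1 a2 a3 a4 a5 a6 a7 a8 ρ u v n 1 t
      - eflux γ a0 a1 a2 a3 a4 a5 a6 a7 a8 ρ u v n 0 t) = 0 := by
    refine (intervalIntegral.integral_congr (g := fun _ => (0:ℝ)) ?_).trans (by simp)
    intro t ht
    rw [uIcc_of_le hτ.1] at ht
    obtain ⟨b1, b2, b3, b4, b5, b6⟩ := hbc t ⟨ht.1, ht.2.trans hτ.2⟩
    simp [eflux, b1, b2, b3, b4, b5, b6]
  rw [hz, add_zero] at G
  have hm := dbl_mono (f := fun x t => pdt (eden γ ρ u v n) x t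
      + pdx (eflux γ a0 a1 a2 a3 a4 a5 a6 a7 a8 ρ u v n) x t)
    (g := fun x t => -c0 * Wq u v n x t) (ce.cpdt.add cF.cpdx)
    (continuous_const.mul (Wq_cont hu hv hn)) hτ.1 (by
      intro x hx t ht
      have ht' : t ∈ Ioo (0:ℝ) T := ⟨ht.1, ht.2.trans_le hτ.2⟩
      have := energy_identity hγ H hx ht'
      simp only [this]
      have hZ := (hpde x hx t ht').2.2.2
      have d := diss (a0 := a0) (a1 := a1) (a4 := a4) (a7 := a7) (a8 := a8) hParodi h3 h6' h7'
        (Real.sin_sq (n x t)) hZ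
      unfold S1 S2 Wq
      have m1 := mul_le_mul_of_nonneg_right k1 (sq_nonneg (pdx (pdx n) x t))
      have m2 := mul_le_mul_of_nonneg_right k2 (sq_nonneg (pdx u x t))
      have m3 := mul_le_mul_of_nonneg_right k3 (sq_nonneg (pdx v x t))
      linarith)
  simp only [intervalIntegral.integral_const_mul] at hm
  linarith

lemma nt_bound {y w N Z U V c s : ℝ} (hy : 0 < y) (hcs : s ^ 2 = 1 - c ^ 2)
    (hZ : y * (N - (1 / 2) * V) - w * (U * c * s + (1 / 2) * V * (1 - 2 * c ^ 2)) = Z) :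
    N ^ 2 ≤ (4 * (1 + y ^ 2 + w ^ 2) / y ^ 2) * (Z ^ 2 + U ^ 2 + V ^ 2) := by
  have hN : y * N = Z + (y / 2) * V + (w * (c * s)) * U + (w / 2 * (1 - 2 * c ^ 2)) * V := by
    linarith
  rw [div_mul_eq_mul_div, le_div_iff₀ (by positivity)]
  have e1 : N ^ 2 * y ^ 2
      = (Z + (y / 2) * V + (w * (c * s)) * U + (w / 2 * (1 - 2 * c ^ 2)) * V) ^ 2 := by
    rw [← hN]; ring
  have four : ∀ p q r o : ℝ, (p + q + r + o) ^ 2 ≤ 4 * (p ^ 2 + q ^ 2 + r ^ 2 + o ^ 2) := by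
    intro p q r o
    nlinarith [sq_nonneg (p - q), sq_nonneg (p - r), sq_nonneg (p - o), sq_nonneg (q - r),
      sq_nonneg (q - o), sq_nonneg (r - o)]
  rw [e1]
  refine (four _ _ _ _).trans ?_
  have c0 : 0 ≤ c ^ 2 := sq_nonneg c
  have c1 : c ^ 2 ≤ 1 := by nlinarith [sq_nonneg s]
  have b1 : (c * s) ^ 2 ≤ 1 := by rw [mul_pow, hcs]; nlinarith
  have b2 : (1 - 2 * c ^ 2) ^ 2 ≤ 1 := by nlinarith
  have d1 : (w * (c * s) * U) ^ 2 ≤ w ^ 2 * U ^ 2 := by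
    have := mul_le_mul_of_nonneg_left b1 (sq_nonneg (w * U))
    nlinarith
  have d2 : (w / 2 * (1 - 2 * c ^ 2) * V) ^ 2 ≤ w ^ 2 * V ^ 2 := by
    have := mul_le_mul_of_nonneg_left b2 (sq_nonneg (w * V))
    nlinarith [sq_nonneg (w * V)]
  have d3 : (y / 2 * V) ^ 2 ≤ y ^ 2 * V ^ 2 := by nlinarith [sq_nonneg (y * V)]
  have : 0 ≤ y ^ 2 * Z ^ 2 := by positivity
  have : 0 ≤ w ^ 2 * Z ^ 2 := by positivity
  have : 0 ≤ y ^ 2 * U ^ 2 := by positivity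
  nlinarith [sq_nonneg U, sq_nonneg V]

/-- Under the Parodi relation and the empirical inequalities on the
Leslie coefficients, there is a nonnegative function `C` of the initial energy and the
time such that every smooth positive-density solution of the one-dimensional
compressible Ericksen–Leslie system on `[0,1] × [0,T]` satisfies
`∫₀ᵀ∫₀¹ n_{xx}² + ∫₀ᵀ∫₀¹ n_t² ≤ C(E(0), T)`. -/
theorem director_second_derivative_estimate
    (γ a0 a1 a2 a3 a4 a5 a6 a7 a8 : ℝ)
    (hγ : 1 < γ)
    (hParodi : a6 - a5 = a2 + a3)
    (h1 : 0 < a4)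
    (h2 : 0 < 2 * a1 + 3 * a4 + 2 * a5 + 2 * a6)
    (h3 : 0 < a3 - a2)
    (h4 : 0 < 2 * a4 + a5 + a6)
    (h5 : (a2 + a3 + (a6 - a5)) ^ 2 < 4 * (a3 - a2) * (2 * a4 + a5 + a6))
    (h6 : a1 + (a6 - a5) ^ 2 / (a3 - a2) < a4 + a7)
    (h6' : 0 ≤ a1 + (a6 - a5) ^ 2 / (a3 - a2))
    (h7 : a0 + a1 + a5 + a6 + a8 < 2 * a4 + a5 + a6 - (a6 - a5) ^ 2 / (a3 - a2))
    (h7' : 0 ≤ a0 + a1 + a5 + a6 + a8) :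
    ∃ C : ℝ → ℝ → ℝ, (∀ e T, 0 ≤ C e T) ∧
      ∀ T : ℝ, 0 < T → ∀ ρ u v n : ℝ → ℝ → ℝ,
        ELSystem γ a0 a1 a2 a3 a4 a5 a6 a7 a8 T ρ u v n →
          (∫ t in (0:ℝ)..T, ∫ x in (0:ℝ)..1, (pdx (pdx n) x t) ^ 2)
            + (∫ t in (0:ℝ)..T, ∫ x in (0:ℝ)..1, (pdt n x t) ^ 2)
          ≤ C (energy γ ρ u v n 0) T := by
  have hp2 : 0 < a4 + a7 - (a1 + (a6 - a5) ^ 2 / (a3 - a2)) := by linarith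
  have hp3 : 0 < (2 * a4 + a5 + a6 - (a6 - a5) ^ 2 / (a3 - a2) - (a0 + a1 + a5 + a6 + a8)) / 4 := by
    linarith
  obtain ⟨c0, hc0, k1, k2, k3⟩ : ∃ c0 : ℝ, 0 < c0 ∧ c0 ≤ 1 / (a3 - a2) ∧
      c0 ≤ a4 + a7 - (a1 + (a6 - a5) ^ 2 / (a3 - a2)) ∧
      c0 ≤ (2 * a4 + a5 + a6 - (a6 - a5) ^ 2 / (a3 - a2) - (a0 + a1 + a5 + a6 + a8)) / 4 :=
    ⟨min (1 / (a3 - a2)) (min _ _), lt_min (one_div_pos.2 h3) (lt_min hp2 hp3), min_le_left _ _,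
      (min_le_right _ _).trans (min_le_left _ _), (min_le_right _ _).trans (min_le_right _ _)⟩
  set K : ℝ := 4 * (1 + (a3 - a2) ^ 2 + (a6 - a5) ^ 2) / (a3 - a2) ^ 2 with hK
  have hK0 : 0 ≤ K := by positivity
  refine ⟨fun e _ => (1 + 2 * K + 4 * |e|) * (|e| / c0), fun e _ => by positivity, ?_⟩
  intro T hT ρ u v n H
  have H' := H
  obtain ⟨hρ, hu, hv, hn, -, hpde, hbc⟩ := H'
  set E0 := energy γ ρ u v n 0 with hE0
  have hEI := fun τ hτ => energy_ineq (τ := τ) hγ hParodi h3 h6' h7' k1 k2 k3 H hτ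
  have hW := Wq_cont hu hv hn
  have hWnn : ∀ x t, 0 ≤ Wq u v n x t := fun x t => by unfold Wq; positivity
  have hIW : ∀ τ, 0 ≤ τ → 0 ≤ ∫ t in (0:ℝ)..τ, ∫ x in (0:ℝ)..1, Wq u v n x t := fun τ hτ =>
    intervalIntegral.integral_nonneg hτ fun t _ =>
      intervalIntegral.integral_nonneg zero_le_one fun x _ => hWnn x t
  have hnx : ∀ t ∈ Icc (0:ℝ) T, (∫ x in (0:ℝ)..1, (pdx n x t) ^ 2) ≤ 2 * E0 := by
    intro t ht
    have q1 := energy_ge hγ H ht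
    have q2 := hEI t ht
    have q3 := mul_nonneg hc0.le (hIW t ht.1)
    linarith
  have hnx0 : ∀ t, 0 ≤ (∫ x in (0:ℝ)..1, (pdx n x t) ^ 2) := fun t =>
    intervalIntegral.integral_nonneg zero_le_one fun x _ => sq_nonneg _
  have hE0nn : 0 ≤ E0 := by
    have := (hnx0 0).trans (hnx 0 ⟨le_rfl, hT.le⟩); linarith
  set I := ∫ t in (0:ℝ)..T, ∫ x in (0:ℝ)..1, Wq u v n x t with hI
  have hIle : I ≤ E0 / c0 := by
    rw [le_div_iff₀ hc0]
    have q2 := hEI T ⟨hT.le, le_rfl⟩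
    have q1 := energy_ge hγ H (t := T) ⟨hT.le, le_rfl⟩
    have := hnx0 T
    linarith
  have cu := hu.continuous
  have cnx := (Sm.pdx hn).continuous
  have cnxx := (Sm.pdx hn).pdx.continuous
  have cnt := (Sm.pdt hn).continuous
  have cun : Continuous (fun p : ℝ × ℝ => (fun x t => u x t ^ 2 * pdx n x t ^ 2) p.1 p.2) :=
    (cu.pow 2).mul (cnx.pow 2)
  have A1 : ∫ t in (0:ℝ)..T, ∫ x in (0:ℝ)..1, (pdx (pdx n) x t) ^ 2 ≤ I :=
    dbl_mono (f := fun x t => (pdx (pdx n) x t) ^ 2) (cnxx.pow 2) hW hT.le fun x _ t _ => by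
      simp only [Wq]; nlinarith [sq_nonneg (pdx u x t), sq_nonneg (pdx v x t)]
  have A2 : ∫ t in (0:ℝ)..T, ∫ x in (0:ℝ)..1, (u x t ^ 2 * pdx n x t ^ 2) ≤ 2 * E0 * I := by
    rw [hI, ← intervalIntegral.integral_const_mul]
    apply intervalIntegral.integral_mono_on_of_le_Ioo hT.le
      ((cont_param (f := fun x t => u x t ^ 2 * pdx n x t ^ 2) cun).intervalIntegrable _ _)
      (((cont_param hW).const_mul _).intervalIntegrable _ _)
    intro t ht
    have ht' := Ioo_subset_Icc_self ht
    have hUW : (∫ y in (0:ℝ)..1, pdx u y t ^ 2) ≤ ∫ x in (0:ℝ)..1, Wq u v n x t := by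
      apply intervalIntegral.integral_mono_on zero_le_one
        (((cont_x (Sm.pdx hu).continuous t).pow 2).intervalIntegrable _ _)
        ((cont_x hW t).intervalIntegrable _ _)
      intro x _
      simp only [Wq, Pi.pow_apply]; nlinarith [sq_nonneg (pdx (pdx n) x t), sq_nonneg (pdx v x t)]
    have hU0 : 0 ≤ ∫ y in (0:ℝ)..1, pdx u y t ^ 2 :=
      intervalIntegral.integral_nonneg zero_le_one fun x _ => sq_nonneg _
    calc ∫ x in (0:ℝ)..1, (u x t ^ 2 * pdx n x t ^ 2)
        ≤ ∫ x in (0:ℝ)..1, (∫ y in (0:ℝ)..1, pdx u y t ^ 2) * pdx n x t ^ 2 := by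
          apply intervalIntegral.integral_mono_on zero_le_one
            ((cont_x (f := fun x t => u x t ^ 2 * pdx n x t ^ 2) cun t).intervalIntegrable _ _)
            ((((cont_x cnx t).pow 2).const_mul _).intervalIntegrable _ _)
          intro x hx
          exact mul_le_mul_of_nonneg_right
            (poinc (Sm.c1 hu) t (hbc t ht').1 x hx) (sq_nonneg _)
      _ = (∫ y in (0:ℝ)..1, pdx u y t ^ 2) * ∫ x in (0:ℝ)..1, pdx n x t ^ 2 :=
          intervalIntegral.integral_const_mul _ _
      _ ≤ (∫ x in (0:ℝ)..1, Wq u v n x t) * (2 * E0) :=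
          mul_le_mul hUW (hnx t ht') (hnx0 t) (hU0.trans hUW)
      _ = 2 * E0 * ∫ x in (0:ℝ)..1, Wq u v n x t := mul_comm _ _
  have A3 : ∫ t in (0:ℝ)..T, ∫ x in (0:ℝ)..1, (pdt n x t) ^ 2 ≤ 2 * K * I
      + 2 * ∫ t in (0:ℝ)..T, ∫ x in (0:ℝ)..1, (u x t ^ 2 * pdx n x t ^ 2) := by
    have := dbl_mono (f := fun x t => (pdt n x t) ^ 2)
      (g := fun x t => 2 * K * Wq u v n x t + 2 * (u x t ^ 2 * pdx n x t ^ 2))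
      (cnt.pow 2) ((hW.const_mul _).add (cun.const_mul _)) hT.le (by
        intro x hx t ht
        have hZ := (hpde x hx t ht).2.2.2
        have b := nt_bound h3 (Real.sin_sq (n x t)) hZ
        rw [← hK] at b
        have b' : mdot u n x t ^ 2 ≤ K * Wq u v n x t := b
        have e : pdt n x t = mdot u n x t - u x t * pdx n x t := by unfold mdot; ring
        show pdt n x t ^ 2 ≤ _
        rw [e]
        nlinarith [sq_nonneg (mdot u n x t + u x t * pdx n x t)])
    refine this.trans (le_of_eq ?_)
    rw [hI, ← intervalIntegral.integral_const_mul, ← intervalIntegral.integral_const_mul,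
      ← intervalIntegral.integral_add (((cont_param hW).const_mul _).intervalIntegrable _ _)
        (((cont_param (f := fun x t => u x t ^ 2 * pdx n x t ^ 2) cun).const_mul _).intervalIntegrable _ _)]
    congr 1; funext t
    rw [intervalIntegral.integral_add (((cont_x hW t).const_mul _).intervalIntegrable _ _)
        (((cont_x (f := fun x t => u x t ^ 2 * pdx n x t ^ 2) cun t).const_mul _).intervalIntegrable _ _),
      intervalIntegral.integral_const_mul, intervalIntegral.integral_const_mul]
  show _ ≤ (1 + 2 * K + 4 * |E0|) * (|E0| / c0)
  rw [abs_of_nonneg hE0nn]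
  have := mul_le_mul_of_nonneg_left hIle (show 0 ≤ 1 + 2 * K + 4 * E0 by positivity)
  linarith

end
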